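/- Let n ≥ 2 and q ≥ 2 be integers and let t be a nonnegative integer. Then ‖law(X_1 + ⋯ + X_t) − Uniform(G)‖_TV² ≤ Σ_y λ_y^{2t}, where the sum is over all nonzero (n−1)×(n−1) matrices y over ℤ/qℤ, and X_1,…,X_t are i.i.d. with law μ. -/

import Mathlib

/-- The matrix `A_{i,j,k,l}` (1-based indices). -/
def DGmat (n q : ℕ) (i j k l : ℕ) : Matrix (Fin n) (Fin n) (ZMod q) :=
  Matrix.of fun a b =>
    (if (a : ℕ) + 1 = i ∧ (b : ℕ) + 1 = k then (1 : ZMod q) else 0)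
  + (if (a : ℕ) + 1 = j ∧ (b : ℕ) + 1 = l then 1 else 0)
  - (if (a : ℕ) + 1 = i ∧ (b : ℕ) + 1 = l then 1 else 0)
  - (if (a : ℕ) + 1 = j ∧ (b : ℕ) + 1 = k then 1 else 0)

/-- The step distribution μ of the Diaconis–Gangolli walk. -/
noncomputable def stepPMF (n q : ℕ) (g : Matrix (Fin n) (Fin n) (ZMod q)) : ℝ :=
  (((((Finset.Icc 1 n ×ˢ Finset.Icc 1 n) ×ˢ (Finset.Icc 1 n ×ˢ Finset.Icc 1 n)) ×ˢ
        (Finset.univ : Finset Bool)).filter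
      (fun p => p.1.1.1 < p.1.1.2 ∧ p.1.2.1 < p.1.2.2 ∧
        (if p.2 then DGmat n q p.1.1.1 p.1.1.2 p.1.2.1 p.1.2.2
         else - DGmat n q p.1.1.1 p.1.1.2 p.1.2.1 p.1.2.2) = g)).card : ℝ)
    / (2 * (n.choose 2 : ℝ) ^ 2)

/-- law of `B_t = x + X_1 + ⋯ + X_t`, `X_i` i.i.d. with law μ. -/
noncomputable def walkDist (n q : ℕ) [NeZero q] (x : Matrix (Fin n) (Fin n) (ZMod q)) :
    ℕ → Matrix (Fin n) (Fin n) (ZMod q) → ℝ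
  | 0 => fun z => if z = x then 1 else 0
  | t + 1 => fun z =>
      ∑ g : Matrix (Fin n) (Fin n) (ZMod q), walkDist n q x t g * stepPMF n q (z - g)

/-- Contingency tables with row sums `r` and column sums `c`. -/
def OmegaSet (n q : ℕ) [NeZero q] (r c : Fin n → ZMod q) :
    Finset (Matrix (Fin n) (Fin n) (ZMod q)) :=
  Finset.univ.filter fun A => (∀ i, ∑ j, A i j = r i) ∧ (∀ j, ∑ i, A i j = c j)

/-- Uniform distribution on `OmegaSet`. -/
noncomputable def unifOmega (n q : ℕ) [NeZero q] (r c : Fin n → ZMod q)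
    (z : Matrix (Fin n) (Fin n) (ZMod q)) : ℝ :=
  if z ∈ OmegaSet n q r c then 1 / ((OmegaSet n q r c).card : ℝ) else 0

/-- Total variation distance. -/
noncomputable def tvDist {X : Type*} [Fintype X] (ν π : X → ℝ) : ℝ :=
  (1 / 2) * ∑ z, |ν z - π z|


/-- The matrix `Ã_{i,j,k,l}` (1-based indices): entry 1 at `(a,c)` iff
`i ≤ a ≤ j` and `k ≤ c ≤ l`. -/
def Atil (n q : ℕ) (i j k l : ℕ) : Matrix (Fin (n - 1)) (Fin (n - 1)) (ZMod q) :=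
  Matrix.of fun a c =>
    if (i ≤ (a : ℕ) + 1 ∧ (a : ℕ) + 1 ≤ j) ∧ (k ≤ (c : ℕ) + 1 ∧ (c : ℕ) + 1 ≤ l)
      then (1 : ZMod q) else 0

/-- Inner product `⟨y, z⟩ = Σ_{a,c} y(a,c)·z(a,c)` in `ℤ/qℤ`. -/
def inner2 {m q : ℕ} (y z : Matrix (Fin m) (Fin m) (ZMod q)) : ZMod q :=
  ∑ a, ∑ c, y a c * z a c

/-- `cos(2πa/q)` for `a ∈ ℤ/qℤ`. -/
noncomputable def zcos (q : ℕ) (a : ZMod q) : ℝ :=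
  Real.cos (2 * Real.pi * (a.val : ℝ) / q)

/-- The eigenvalue `λ_y`. -/
noncomputable def lamEig (n q : ℕ) (y : Matrix (Fin (n - 1)) (Fin (n - 1)) (ZMod q)) : ℝ :=
  (1 / (n.choose 2 : ℝ) ^ 2) *
    ∑ i ∈ Finset.Icc 1 (n - 1), ∑ j ∈ Finset.Icc i (n - 1),
      ∑ k ∈ Finset.Icc 1 (n - 1), ∑ l ∈ Finset.Icc k (n - 1),
        zcos q (inner2 y (Atil n q i j k l))


/-- The sum of the entries of `A` in its first `a` rows and first `c` columns. -/
def cornerSum {n q : ℕ} (A : Matrix (Fin n) (Fin n) (ZMod q)) (a c : ℕ) : ZMod q :=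
  ∑ i : Fin n, ∑ j : Fin n, if (i : ℕ) < a ∧ (j : ℕ) < c then A i j else 0

lemma cornerSum_add {n q : ℕ} (A B : Matrix (Fin n) (Fin n) (ZMod q)) (a c : ℕ) :
    cornerSum (A + B) a c = cornerSum A a c + cornerSum B a c := by
  simp only [cornerSum, ← Finset.sum_add_distrib]
  refine Finset.sum_congr rfl fun i _ => Finset.sum_congr rfl fun j _ => ?_
  split_ifs <;> simp

/-- The additive map sending a matrix to the matrix of its proper corner sums. -/
def cornerSums (n q : ℕ) :
    Matrix (Fin n) (Fin n) (ZMod q) →+ Matrix (Fin (n - 1)) (Fin (n - 1)) (ZMod q) where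
  toFun A := Matrix.of fun a c => cornerSum A (a + 1) (c + 1)
  map_zero' := by ext; simp [cornerSum]
  map_add' A B := by ext; simp [cornerSum_add]

lemma cornerSums_apply {n q : ℕ} (A : Matrix (Fin n) (Fin n) (ZMod q)) (a c : Fin (n - 1)) :
    cornerSums n q A a c = cornerSum A (a + 1) (c + 1) := rfl

lemma sum_ite_lt_and_succ_eq {n q : ℕ} (i a : ℕ) (hi : 1 ≤ i) (hin : i ≤ n) :
    (∑ x : Fin n, if (x : ℕ) < a ∧ (x : ℕ) + 1 = i then (1 : ZMod q) else 0)
      = if i ≤ a then 1 else 0 := by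
  rw [Finset.sum_eq_single (⟨i - 1, by omega⟩ : Fin n)]
  · exact if_congr (by simp only; omega) rfl rfl
  · intro b _ hb
    refine if_neg fun h => hb (Fin.ext ?_)
    simp only; omega
  · simp

lemma sum_sum_ite_lt_ite_succ_eq {n q : ℕ} (i k a c : ℕ) (hi : 1 ≤ i) (hin : i ≤ n)
    (hk : 1 ≤ k) (hkn : k ≤ n) :
    (∑ x : Fin n, ∑ y : Fin n, if (x : ℕ) < a ∧ (y : ℕ) < c then
        (if (x : ℕ) + 1 = i ∧ (y : ℕ) + 1 = k then (1 : ZMod q) else 0) else 0)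
      = if i ≤ a ∧ k ≤ c then 1 else 0 := by
  calc _ = (∑ x : Fin n, if (x : ℕ) < a ∧ (x : ℕ) + 1 = i then (1 : ZMod q) else 0) *
        ∑ y : Fin n, if (y : ℕ) < c ∧ (y : ℕ) + 1 = k then (1 : ZMod q) else 0 := by
        rw [Finset.sum_mul_sum]
        refine Finset.sum_congr rfl fun x _ => Finset.sum_congr rfl fun y _ => ?_
        by_cases h1 : (x : ℕ) < a <;> by_cases h2 : (y : ℕ) < c <;>
          by_cases h3 : (x : ℕ) + 1 = i <;> simp [h1, h2, h3]
    _ = _ := by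
        rw [sum_ite_lt_and_succ_eq i a hi hin, sum_ite_lt_and_succ_eq k c hk hkn]
        by_cases h1 : i ≤ a <;> simp [h1]

lemma cornerSums_DGmat {n q : ℕ} {i j k l : ℕ} (hi : 1 ≤ i) (hij : i < j) (hj : j ≤ n)
    (hk : 1 ≤ k) (hkl : k < l) (hl : l ≤ n) :
    cornerSums n q (DGmat n q i j k l) = Atil n q i (j - 1) k (l - 1) := by
  ext a c
  have h : cornerSum (DGmat n q i j k l) (a + 1) (c + 1) =
      (if i ≤ (a : ℕ) + 1 ∧ k ≤ (c : ℕ) + 1 then (1 : ZMod q) else 0)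
      + (if j ≤ (a : ℕ) + 1 ∧ l ≤ (c : ℕ) + 1 then 1 else 0)
      - (if i ≤ (a : ℕ) + 1 ∧ l ≤ (c : ℕ) + 1 then 1 else 0)
      - (if j ≤ (a : ℕ) + 1 ∧ k ≤ (c : ℕ) + 1 then 1 else 0) := by
    rw [← sum_sum_ite_lt_ite_succ_eq (n := n) i k _ _ hi (by omega) hk (by omega),
      ← sum_sum_ite_lt_ite_succ_eq (n := n) j l _ _ (by omega) (by omega) (by omega) (by omega),
      ← sum_sum_ite_lt_ite_succ_eq (n := n) i l _ _ (by omega) (by omega) (by omega) (by omega),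
      ← sum_sum_ite_lt_ite_succ_eq (n := n) j k _ _ (by omega) (by omega) (by omega) (by omega)]
    simp only [cornerSum, ← Finset.sum_add_distrib, ← Finset.sum_sub_distrib]
    refine Finset.sum_congr rfl fun x _ => Finset.sum_congr rfl fun y _ => ?_
    by_cases hxy : (x : ℕ) < a + 1 ∧ (y : ℕ) < c + 1
    · simp only [if_pos hxy, DGmat, Matrix.of_apply]
    · simp only [if_neg hxy]; simp
  rw [cornerSums_apply, h]
  simp only [Atil, Matrix.of_apply]
  have h5 : (a : ℕ) + 1 ≤ j - 1 ↔ ¬ j ≤ (a : ℕ) + 1 := by omega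
  have h6 : (c : ℕ) + 1 ≤ l - 1 ↔ ¬ l ≤ (c : ℕ) + 1 := by omega
  by_cases h1 : i ≤ (a : ℕ) + 1 <;> by_cases h2 : j ≤ (a : ℕ) + 1 <;>
    by_cases h3 : k ≤ (c : ℕ) + 1 <;> by_cases h4 : l ≤ (c : ℕ) + 1 <;>
    first
    | (exfalso; omega)
    | simp [h1, h2, h3, h4, h5, h6]

lemma DGmat_mem_OmegaSet {n q : ℕ} [NeZero q] {i j k l : ℕ} (hi : 1 ≤ i) (hij : i < j)
    (hj : j ≤ n) (hk : 1 ≤ k) (hkl : k < l) (hl : l ≤ n) :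
    DGmat n q i j k l ∈ OmegaSet n q 0 0 := by
  have key (p : Prop) [Decidable p] (k : ℕ) (hk : 1 ≤ k) (hkn : k ≤ n) :
      (∑ x : Fin n, if p ∧ (x : ℕ) + 1 = k then (1 : ZMod q) else 0) = if p then 1 else 0 := by
    have := sum_ite_lt_and_succ_eq (q := q) k n hk hkn
    simp only [Fin.is_lt, true_and, if_pos hkn] at this
    by_cases hp : p <;> simp [hp, this]
  have key' (p : Prop) [Decidable p] (k : ℕ) (hk : 1 ≤ k) (hkn : k ≤ n) :
      (∑ x : Fin n, if (x : ℕ) + 1 = k ∧ p then (1 : ZMod q) else 0) = if p then 1 else 0 := by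
    simp only [and_comm (b := p)]
    exact key p k hk hkn
  simp only [OmegaSet, Finset.mem_filter, Finset.mem_univ, true_and, Pi.zero_apply]
  constructor <;> intro x <;>
    simp only [DGmat, Matrix.of_apply, Finset.sum_sub_distrib, Finset.sum_add_distrib]
  · rw [key _ k (by omega) (by omega), key _ k (by omega) (by omega),
      key _ l (by omega) (by omega), key _ l (by omega) (by omega)]
    ring
  · rw [key' _ i (by omega) (by omega), key' _ i (by omega) (by omega),
      key' _ j (by omega) (by omega), key' _ j (by omega) (by omega)]
    ring

lemma zero_mem_OmegaSet (n q : ℕ) [NeZero q] : 0 ∈ OmegaSet n q 0 0 := by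
  simp [OmegaSet]

lemma add_mem_OmegaSet {n q : ℕ} [NeZero q] {A B : Matrix (Fin n) (Fin n) (ZMod q)}
    (hA : A ∈ OmegaSet n q 0 0) (hB : B ∈ OmegaSet n q 0 0) : A + B ∈ OmegaSet n q 0 0 := by
  simp_all [OmegaSet, Finset.sum_add_distrib]

lemma neg_mem_OmegaSet {n q : ℕ} [NeZero q] {A : Matrix (Fin n) (Fin n) (ZMod q)}
    (hA : A ∈ OmegaSet n q 0 0) : -A ∈ OmegaSet n q 0 0 := by
  simp_all [OmegaSet]

lemma entry_eq_cornerSum {n q : ℕ} (A : Matrix (Fin n) (Fin n) (ZMod q)) (a c : Fin n) :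
    A a c = cornerSum A (a + 1) (c + 1) - cornerSum A a (c + 1) - cornerSum A (a + 1) c
      + cornerSum A a c := by
  simp only [cornerSum, ← Finset.sum_sub_distrib, ← Finset.sum_add_distrib]
  rw [Finset.sum_eq_single a, Finset.sum_eq_single c]
  · simp
  · intro b _ hb
    have : (b : ℕ) ≠ c := fun h => hb (Fin.ext h)
    have h1 : (b : ℕ) < c + 1 ↔ (b : ℕ) < c := by omega
    simp [h1]
  · simp
  · intro b _ hb
    have : (b : ℕ) ≠ a := fun h => hb (Fin.ext h)
    have h1 : (b : ℕ) < a + 1 ↔ (b : ℕ) < a := by omega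
    simp [h1]
  · simp

lemma cornerSums_injOn (n q : ℕ) [NeZero q] :
    Set.InjOn (cornerSums n q) (OmegaSet n q 0 0) := by
  have ker {A : Matrix (Fin n) (Fin n) (ZMod q)} (hA : A ∈ OmegaSet n q 0 0)
      (h0 : cornerSums n q A = 0) : A = 0 := by
    simp only [OmegaSet, Finset.mem_filter, Finset.mem_univ, true_and, Pi.zero_apply] at hA
    have hz (a c : ℕ) (ha : a ≤ n) (hc : c ≤ n) : cornerSum A a c = 0 := by
      rcases Nat.eq_zero_or_pos a with rfl | ha0
      · simp [cornerSum]
      rcases Nat.eq_zero_or_pos c with rfl | hc0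
      · simp [cornerSum]
      rcases ha.eq_or_lt with rfl | ha
      · rw [cornerSum, Finset.sum_comm]
        refine Finset.sum_eq_zero fun j _ => ?_
        by_cases hj : (j : ℕ) < c <;> simp [hj, hA.2 j]
      rcases hc.eq_or_lt with rfl | hc
      · refine Finset.sum_eq_zero fun i _ => ?_
        by_cases hi : (i : ℕ) < a <;> simp [hi, hA.1 i]
      · have := congrFun (congrFun h0 ⟨a - 1, by omega⟩) ⟨c - 1, by omega⟩
        rw [cornerSums_apply] at this
        simpa [Nat.sub_add_cancel ha0, Nat.sub_add_cancel hc0] using this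
    ext a c
    rw [entry_eq_cornerSum A a c, hz _ _ a.2 c.2, hz _ _ a.2.le c.2, hz _ _ a.2 c.2.le,
      hz _ _ a.2.le c.2.le]
    simp
  intro A hA B hB h
  rw [← sub_eq_zero, sub_eq_add_neg]
  refine ker (add_mem_OmegaSet hA (neg_mem_OmegaSet hB)) ?_
  rw [map_add, map_neg, h, add_neg_cancel]

lemma stepPMF_eq_zero {n q : ℕ} [NeZero q] {g : Matrix (Fin n) (Fin n) (ZMod q)}
    (hg : g ∉ OmegaSet n q 0 0) : stepPMF n q g = 0 := by
  rw [stepPMF, Finset.filter_eq_empty_iff.2, Finset.card_empty, Nat.cast_zero, zero_div]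
  rintro ⟨⟨⟨i, j⟩, k, l⟩, b⟩ hp ⟨hij, hkl, rfl⟩
  simp only [Finset.mem_product, Finset.mem_Icc, Finset.mem_univ, and_true] at hp hij hkl
  have := DGmat_mem_OmegaSet (q := q) hp.1.1.1 hij hp.1.2.2 hp.2.1.1 hkl hp.2.2.2
  cases b
  · exact hg (by simpa using neg_mem_OmegaSet this)
  · exact hg (by simpa using this)

lemma walkDist_eq_zero {n q : ℕ} [NeZero q] (t : ℕ) {z : Matrix (Fin n) (Fin n) (ZMod q)}
    (hz : z ∉ OmegaSet n q 0 0) : walkDist n q 0 t z = 0 := by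
  induction t generalizing z with
  | zero =>
    simp only [walkDist]
    refine if_neg ?_
    rintro rfl
    exact hz (zero_mem_OmegaSet n q)
  | succ t ih =>
    refine Finset.sum_eq_zero fun g _ => ?_
    by_cases hg : g ∈ OmegaSet n q 0 0
    · rw [stepPMF_eq_zero, mul_zero]
      intro h
      exact hz (by simpa using add_mem_OmegaSet hg h)
    · rw [ih hg, zero_mul]

lemma sum_lt_eq_sum_le {M : Type*} [AddCommMonoid M] (n : ℕ) (F : ℕ → ℕ → M) :
    (∑ i ∈ Finset.Icc 1 n, ∑ j ∈ Finset.Icc 1 n, if i < j then F i (j - 1) else 0)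
      = ∑ i ∈ Finset.Icc 1 (n - 1), ∑ j ∈ Finset.Icc i (n - 1), F i j := by
  simp only [← Finset.sum_filter]
  rw [Finset.sum_sigma', Finset.sum_sigma']
  refine Finset.sum_nbij' (fun p => ⟨p.1, p.2 - 1⟩) (fun p => ⟨p.1, p.2 + 1⟩) ?_ ?_ ?_ ?_ ?_
  · rintro ⟨i, j⟩ h
    simp only [Finset.mem_sigma, Finset.mem_filter, Finset.mem_Icc] at h ⊢
    omega
  · rintro ⟨i, j⟩ h
    simp only [Finset.mem_sigma, Finset.mem_filter, Finset.mem_Icc] at h ⊢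
    omega
  · rintro ⟨i, j⟩ h
    simp only [Finset.mem_sigma, Finset.mem_filter, Finset.mem_Icc] at h
    simp only [Sigma.mk.injEq, heq_eq_eq, true_and]
    omega
  · rintro ⟨i, j⟩ h
    simp
  · rintro ⟨i, j⟩ h
    rfl

lemma sum_stepPMF_mul {n q : ℕ} [NeZero q] (F : Matrix (Fin n) (Fin n) (ZMod q) → ℂ) :
    ∑ g, (stepPMF n q g : ℂ) * F g = 1 / (2 * (n.choose 2 : ℂ) ^ 2) *
      ∑ i ∈ Finset.Icc 1 n, ∑ j ∈ Finset.Icc 1 n, if i < j then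
        ∑ k ∈ Finset.Icc 1 n, ∑ l ∈ Finset.Icc 1 n, if k < l then
          F (DGmat n q i j k l) + F (-DGmat n q i j k l) else 0 else 0 := by
  have h (g : Matrix (Fin n) (Fin n) (ZMod q)) : (stepPMF n q g : ℂ) * F g =
      1 / (2 * (n.choose 2 : ℂ) ^ 2) *
      ∑ i ∈ Finset.Icc 1 n, ∑ j ∈ Finset.Icc 1 n, if i < j then
        ∑ k ∈ Finset.Icc 1 n, ∑ l ∈ Finset.Icc 1 n, if k < l then
          ((if DGmat n q i j k l = g then F g else 0)
            + if -DGmat n q i j k l = g then F g else 0) else 0 else 0 := by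
    rw [stepPMF, Finset.card_filter]
    simp only [Finset.sum_product, Fintype.sum_bool]
    push_cast
    rw [div_mul_eq_mul_div, div_eq_mul_one_div, mul_comm]
    congr 1
    simp only [Finset.sum_mul]
    refine Finset.sum_congr rfl fun i _ => Finset.sum_congr rfl fun j _ => ?_
    by_cases hij : i < j
    · simp only [hij, if_true, true_and]
      refine Finset.sum_congr rfl fun k _ => Finset.sum_congr rfl fun l _ => ?_
      by_cases hkl : k < l
      · simp only [hkl, if_true, true_and]
        split_ifs <;> push_cast <;> ring
      · simp [hkl]
    · simp [hij]
  simp only [h]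
  rw [← Finset.mul_sum]
  congr 1
  rw [Finset.sum_comm]
  refine Finset.sum_congr rfl fun i _ => ?_
  rw [Finset.sum_comm]
  refine Finset.sum_congr rfl fun j _ => ?_
  by_cases hij : i < j
  · simp only [hij, if_true]
    rw [Finset.sum_comm]
    refine Finset.sum_congr rfl fun k _ => ?_
    rw [Finset.sum_comm]
    refine Finset.sum_congr rfl fun l _ => ?_
    by_cases hkl : k < l <;> simp [hkl, Finset.sum_add_distrib]
  · simp [hij]

lemma inner2_add_right {m q : ℕ} (y z w : Matrix (Fin m) (Fin m) (ZMod q)) :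
    inner2 y (z + w) = inner2 y z + inner2 y w := by
  simp [inner2, mul_add, Finset.sum_add_distrib]

lemma inner2_neg_right {m q : ℕ} (y z : Matrix (Fin m) (Fin m) (ZMod q)) :
    inner2 y (-z) = -inner2 y z := by
  simp [inner2]

lemma inner2_add_left {m q : ℕ} (y z w : Matrix (Fin m) (Fin m) (ZMod q)) :
    inner2 (y + z) w = inner2 y w + inner2 z w := by
  simp [inner2, add_mul, Finset.sum_add_distrib]

lemma inner2_zero_right {m q : ℕ} (y : Matrix (Fin m) (Fin m) (ZMod q)) :
    inner2 y 0 = 0 := by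
  simp [inner2]

lemma inner2_zero_left {m q : ℕ} (y : Matrix (Fin m) (Fin m) (ZMod q)) :
    inner2 0 y = 0 := by
  simp [inner2]

lemma inner2_single_left {m q : ℕ} (a c : Fin m) (y : Matrix (Fin m) (Fin m) (ZMod q)) :
    inner2 (Matrix.single a c 1) y = y a c := by
  rw [inner2, Finset.sum_eq_single a, Finset.sum_eq_single c]
  · simp
  · intro b _ hb
    simp [hb.symm]
  · simp
  · intro b _ hb
    simp [hb.symm]
  · simp

lemma exists_ne_of_ne_zero {m q : ℕ} {w : Matrix (Fin m) (Fin m) (ZMod q)} (hw : w ≠ 0) :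
    ∃ a c, w a c ≠ 0 := by
  by_contra! h
  exact hw (by ext a c; exact h a c)

lemma stdAddChar_ne_one {q : ℕ} [NeZero q] {a : ZMod q} (ha : a ≠ 0) :
    ZMod.stdAddChar a ≠ 1 := by
  rwa [← (ZMod.stdAddChar (N := q)).map_zero_eq_one, ZMod.injective_stdAddChar.ne_iff]

lemma sum_stdAddChar_inner2 {m q : ℕ} [NeZero q] (w : Matrix (Fin m) (Fin m) (ZMod q)) :
    ∑ y : Matrix (Fin m) (Fin m) (ZMod q), ZMod.stdAddChar (inner2 y w)
      = if w = 0 then (Fintype.card (Matrix (Fin m) (Fin m) (ZMod q)) : ℂ) else 0 := by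
  split_ifs with hw
  · simp [hw, inner2_zero_right]
  · obtain ⟨a, c, hac⟩ := exists_ne_of_ne_zero hw
    refine eq_zero_of_mul_eq_self_left (stdAddChar_ne_one hac) ?_
    rw [Finset.mul_sum]
    refine Fintype.sum_equiv (Equiv.addLeft (Matrix.single a c 1)) _ _ fun y => ?_
    rw [Equiv.coe_addLeft, inner2_add_left, AddChar.map_add_eq_mul, inner2_single_left]

/-- The Fourier transform at `y` of a function on matrices, through the corner sums. -/
noncomputable def cornerFourier {n q : ℕ} [NeZero q]
    (f : Matrix (Fin n) (Fin n) (ZMod q) → ℝ)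
    (y : Matrix (Fin (n - 1)) (Fin (n - 1)) (ZMod q)) : ℂ :=
  ∑ A, (f A : ℂ) * ZMod.stdAddChar (inner2 y (cornerSums n q A))

lemma cornerFourier_sub {n q : ℕ} [NeZero q] (f g : Matrix (Fin n) (Fin n) (ZMod q) → ℝ)
    (y : Matrix (Fin (n - 1)) (Fin (n - 1)) (ZMod q)) :
    cornerFourier (fun A => f A - g A) y = cornerFourier f y - cornerFourier g y := by
  simp [cornerFourier, sub_mul]

lemma sum_cornerFourier_mul_conj {n q : ℕ} [NeZero q]
    (f : Matrix (Fin n) (Fin n) (ZMod q) → ℝ) (hf : ∀ A ∉ OmegaSet n q 0 0, f A = 0) :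
    ∑ y, cornerFourier f y * (starRingEnd ℂ) (cornerFourier f y)
      = (Fintype.card (Matrix (Fin (n - 1)) (Fin (n - 1)) (ZMod q)) : ℂ) *
        ∑ A, (f A : ℂ) ^ 2 := by
  have h (y : Matrix (Fin (n - 1)) (Fin (n - 1)) (ZMod q)) :
      cornerFourier f y * (starRingEnd ℂ) (cornerFourier f y) = ∑ A, ∑ B, (f A : ℂ) * f B *
        ZMod.stdAddChar (inner2 y (cornerSums n q A + -cornerSums n q B)) := by
    rw [cornerFourier, map_sum, Finset.sum_mul_sum]
    refine Finset.sum_congr rfl fun A _ => Finset.sum_congr rfl fun B _ => ?_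
    rw [map_mul, Complex.conj_ofReal, ← AddChar.map_neg_eq_conj, inner2_add_right,
      inner2_neg_right, AddChar.map_add_eq_mul]
    ring
  simp only [h]
  rw [Finset.sum_comm, Finset.mul_sum]
  refine Finset.sum_congr rfl fun A _ => ?_
  rw [Finset.sum_comm]
  simp only [← Finset.mul_sum, sum_stdAddChar_inner2]
  rw [Finset.sum_eq_single A]
  · simp
    ring
  · intro B _ hBA
    by_cases hA : A ∈ OmegaSet n q 0 0
    · by_cases hB : B ∈ OmegaSet n q 0 0
      · rw [if_neg, mul_zero]
        intro h
        rw [← sub_eq_add_neg, sub_eq_zero] at h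
        exact hBA (cornerSums_injOn n q hA hB h).symm
      · simp [hf B hB]
    · simp [hf A hA]
  · simp

lemma two_mul_zcos {q : ℕ} [NeZero q] (a : ZMod q) :
    2 * (zcos q a : ℂ) = ZMod.stdAddChar a + ZMod.stdAddChar (-a) := by
  rw [AddChar.map_neg_eq_conj, Complex.add_conj, ZMod.stdAddChar_apply, ZMod.toCircle_apply]
  have : (2 * Real.pi * Complex.I * a.val / q : ℂ)
      = ((2 * Real.pi * a.val / q : ℝ) : ℂ) * Complex.I := by
    push_cast
    ring
  rw [this, Complex.exp_ofReal_mul_I_re, zcos]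
  push_cast
  rfl

lemma cornerFourier_stepPMF {n q : ℕ} [NeZero q]
    (y : Matrix (Fin (n - 1)) (Fin (n - 1)) (ZMod q)) :
    cornerFourier (stepPMF n q) y = lamEig n q y := by
  rw [cornerFourier, sum_stepPMF_mul]
  have h : (∑ i ∈ Finset.Icc 1 n, ∑ j ∈ Finset.Icc 1 n, if i < j then
        ∑ k ∈ Finset.Icc 1 n, ∑ l ∈ Finset.Icc 1 n, if k < l then
          ZMod.stdAddChar (inner2 y (cornerSums n q (DGmat n q i j k l)))
          + ZMod.stdAddChar (inner2 y (cornerSums n q (-DGmat n q i j k l))) else 0 else 0)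
      = ∑ i ∈ Finset.Icc 1 n, ∑ j ∈ Finset.Icc 1 n, if i < j then
        ∑ k ∈ Finset.Icc 1 n, ∑ l ∈ Finset.Icc 1 n, (if k < l then
          2 * (zcos q (inner2 y (Atil n q i (j - 1) k (l - 1))) : ℂ) else 0) else 0 := by
    refine Finset.sum_congr rfl fun i hi => Finset.sum_congr rfl fun j hj => ?_
    refine if_ctx_congr Iff.rfl (fun hij => ?_) fun _ => rfl
    refine Finset.sum_congr rfl fun k hk => Finset.sum_congr rfl fun l hl => ?_
    refine if_ctx_congr Iff.rfl (fun hkl => ?_) fun _ => rfl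
    rw [Finset.mem_Icc] at hi hj hk hl
    rw [map_neg, cornerSums_DGmat hi.1 hij hj.2 hk.1 hkl hl.2, inner2_neg_right, two_mul_zcos]
  rw [h, sum_lt_eq_sum_le n fun i j => ∑ k ∈ Finset.Icc 1 n, ∑ l ∈ Finset.Icc 1 n,
    (if k < l then 2 * (zcos q (inner2 y (Atil n q i j k (l - 1))) : ℂ) else 0)]
  simp only [fun i j => sum_lt_eq_sum_le n fun k l =>
    2 * (zcos q (inner2 y (Atil n q i j k l)) : ℂ)]
  simp only [← Finset.mul_sum]
  rw [lamEig]
  push_cast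
  rw [← mul_assoc]
  congr 1
  rw [one_div, one_div, mul_inv]
  ring

lemma cornerFourier_walkDist {n q : ℕ} [NeZero q] (t : ℕ)
    (y : Matrix (Fin (n - 1)) (Fin (n - 1)) (ZMod q)) :
    cornerFourier (walkDist n q 0 t) y = lamEig n q y ^ t := by
  induction t with
  | zero =>
    rw [cornerFourier, Finset.sum_eq_single 0]
    · simp [walkDist, inner2_zero_right]
    · intro A _ hA
      simp [walkDist, hA]
    · simp
  | succ t ih =>
    rw [pow_succ, ← ih, ← cornerFourier_stepPMF]
    simp only [cornerFourier, walkDist, Finset.sum_mul_sum]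
    push_cast
    simp only [Finset.sum_mul]
    rw [Finset.sum_comm]
    refine Finset.sum_congr rfl fun g _ => ?_
    refine (Fintype.sum_equiv (Equiv.addLeft g) _ _ fun z => ?_).symm
    rw [Equiv.coe_addLeft, add_sub_cancel_left, map_add, inner2_add_right,
      AddChar.map_add_eq_mul]
    ring

lemma sum_Icc_card_Icc (m : ℕ) :
    ∑ i ∈ Finset.Icc 1 m, (Finset.Icc i m).card = (m + 1).choose 2 := by
  induction m with
  | zero => rfl
  | succ m ih =>
    rw [Finset.sum_Icc_succ_top (by omega), Nat.choose_succ_succ' (m + 1), ← ih]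
    have : ∑ i ∈ Finset.Icc 1 m, (Finset.Icc i (m + 1)).card
        = ∑ i ∈ Finset.Icc 1 m, ((Finset.Icc i m).card + 1) := by
      refine Finset.sum_congr rfl fun i hi => ?_
      rw [Finset.mem_Icc] at hi
      simp only [Nat.card_Icc]
      omega
    rw [this, Finset.sum_add_distrib]
    simp
    omega

lemma lamEig_zero {n q : ℕ} [NeZero q] (hn : 2 ≤ n) : lamEig n q 0 = 1 := by
  have hc : (n.choose 2 : ℝ) ≠ 0 := by
    exact_mod_cast (Nat.choose_pos hn).ne'
  have h : (∑ i ∈ Finset.Icc 1 (n - 1), ((Finset.Icc i (n - 1)).card : ℝ)) = n.choose 2 := by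
    have := sum_Icc_card_Icc (n - 1)
    rw [Nat.sub_add_cancel (by omega)] at this
    exact_mod_cast this
  simp only [lamEig, inner2_zero_left, zcos, ZMod.val_zero, Nat.cast_zero, mul_zero, zero_div,
    Real.cos_zero, Finset.sum_const, nsmul_eq_mul, mul_one, h, ← Finset.sum_mul]
  field_simp

lemma cornerFourier_unifOmega_zero {n q : ℕ} [NeZero q] :
    cornerFourier (unifOmega n q 0 0) 0 = 1 := by
  have hc : ((OmegaSet n q 0 0).card : ℂ) ≠ 0 := by
    exact_mod_cast (Finset.card_pos.2 ⟨0, zero_mem_OmegaSet n q⟩).ne'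
  simp only [cornerFourier, unifOmega, inner2_zero_left, AddChar.map_zero_eq_one, mul_one]
  simp only [apply_ite Complex.ofReal, Complex.ofReal_zero]
  rw [Finset.sum_ite_mem, Finset.univ_inter, Finset.sum_const, nsmul_eq_mul]
  push_cast
  exact mul_one_div_cancel hc

lemma inner2_Atil_self {n q : ℕ} (y : Matrix (Fin (n - 1)) (Fin (n - 1)) (ZMod q))
    (a c : Fin (n - 1)) : inner2 y (Atil n q (a + 1) (a + 1) (c + 1) (c + 1)) = y a c := by
  have h : Atil n q (a + 1) (a + 1) (c + 1) (c + 1) = Matrix.single a c 1 := by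
    ext b d
    rw [Matrix.single_apply, Atil, Matrix.of_apply]
    refine if_congr ?_ rfl rfl
    rw [Fin.ext_iff, Fin.ext_iff]
    omega
  rw [h, ← inner2_single_left a c y]
  simp only [inner2, mul_comm]

lemma cornerFourier_unifOmega_of_ne_zero {n q : ℕ} [NeZero q]
    {y : Matrix (Fin (n - 1)) (Fin (n - 1)) (ZMod q)} (hy : y ≠ 0) :
    cornerFourier (unifOmega n q 0 0) y = 0 := by
  obtain ⟨a, c, hac⟩ := exists_ne_of_ne_zero hy
  have ha := a.2
  have hc := c.2
  have hD := DGmat_mem_OmegaSet (n := n) (q := q) (i := a + 1) (j := a + 2) (k := c + 1)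
    (l := c + 2) (by omega) (by omega) (by omega) (by omega) (by omega) (by omega)
  have hS := cornerSums_DGmat (n := n) (q := q) (i := a + 1) (j := a + 2) (k := c + 1)
    (l := c + 2) (by omega) (by omega) (by omega) (by omega) (by omega) (by omega)
  set D := DGmat n q (a + 1) (a + 2) (c + 1) (c + 2)
  refine eq_zero_of_mul_eq_self_left (stdAddChar_ne_one hac) ?_
  rw [cornerFourier, Finset.mul_sum]
  refine Fintype.sum_equiv (Equiv.addLeft D) _ _ fun A => ?_
  have hu : unifOmega n q 0 0 (D + A) = unifOmega n q 0 0 A := by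
    refine if_congr ⟨fun h => ?_, add_mem_OmegaSet hD⟩ rfl rfl
    simpa using add_mem_OmegaSet (neg_mem_OmegaSet hD) h
  rw [Equiv.coe_addLeft, hu, map_add, inner2_add_right, AddChar.map_add_eq_mul, hS]
  simp only [show ∀ m : ℕ, m + 2 - 1 = m + 1 from fun _ => rfl,
    inner2_Atil_self]
  ring

lemma card_OmegaSet_le (n q : ℕ) [NeZero q] :
    (OmegaSet n q 0 0).card ≤ Fintype.card (Matrix (Fin (n - 1)) (Fin (n - 1)) (ZMod q)) :=
  Finset.card_le_card_of_injOn (cornerSums n q) (fun _ _ => Finset.mem_univ _)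
    (cornerSums_injOn n q)

theorem stmt6 (n q : ℕ) [NeZero q] (hn : 2 ≤ n) (hq : 2 ≤ q) (t : ℕ) :
    (tvDist (walkDist n q 0 t) (unifOmega n q 0 0)) ^ 2
      ≤ ∑ y ∈ Finset.univ.filter
            (fun y : Matrix (Fin (n - 1)) (Fin (n - 1)) (ZMod q) => y ≠ 0),
          lamEig n q y ^ (2 * t) := by
  set f : Matrix (Fin n) (Fin n) (ZMod q) → ℝ :=
    fun A => walkDist n q 0 t A - unifOmega n q 0 0 A with hf_def
  set N : ℝ := (Fintype.card (Matrix (Fin (n - 1)) (Fin (n - 1)) (ZMod q)) : ℝ)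
  have hf : ∀ A ∉ OmegaSet n q 0 0, f A = 0 := fun A hA => by
    simp [hf_def, walkDist_eq_zero t hA, unifOmega, hA]
  have hfourier (y : Matrix (Fin (n - 1)) (Fin (n - 1)) (ZMod q)) :
      cornerFourier f y * (starRingEnd ℂ) (cornerFourier f y)
        = ((if y ≠ 0 then lamEig n q y ^ (2 * t) else 0 : ℝ) : ℂ) := by
    rw [hf_def, cornerFourier_sub, cornerFourier_walkDist]
    split_ifs with hy
    · rw [cornerFourier_unifOmega_of_ne_zero hy, sub_zero, map_pow, Complex.conj_ofReal]
      push_cast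
      ring
    · rw [not_not.1 hy, cornerFourier_unifOmega_zero, lamEig_zero hn]
      simp
  have hplancherel : N * ∑ A, f A ^ 2 = ∑ y ∈ Finset.univ.filter
      (fun y : Matrix (Fin (n - 1)) (Fin (n - 1)) (ZMod q) => y ≠ 0), lamEig n q y ^ (2 * t) := by
    have h := sum_cornerFourier_mul_conj f hf
    simp only [hfourier] at h
    rw [Finset.sum_filter]
    exact_mod_cast h.symm
  have hsq : 0 ≤ ∑ A, f A ^ 2 := Finset.sum_nonneg fun _ _ => sq_nonneg _
  have hcs : (∑ A, |f A|) ^ 2 ≤ N * ∑ A, f A ^ 2 := by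
    calc (∑ A, |f A|) ^ 2 = (∑ A ∈ OmegaSet n q 0 0, |f A|) ^ 2 := by
          rw [Finset.sum_subset (Finset.subset_univ (OmegaSet n q 0 0))]
          intro A _ hA
          rw [hf A hA, abs_zero]
      _ ≤ (OmegaSet n q 0 0).card * ∑ A ∈ OmegaSet n q 0 0, |f A| ^ 2 :=
          sq_sum_le_card_mul_sum_sq
      _ ≤ N * ∑ A, f A ^ 2 := by
          simp only [sq_abs]
          refine mul_le_mul (Nat.cast_le.2 (card_OmegaSet_le n q)) ?_
            (Finset.sum_nonneg fun _ _ => sq_nonneg _) (Nat.cast_nonneg _)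
          exact Finset.sum_le_sum_of_subset_of_nonneg (Finset.subset_univ _)
            fun _ _ _ => sq_nonneg _
  have hN0 : 0 ≤ N * ∑ A, f A ^ 2 := mul_nonneg (Nat.cast_nonneg _) hsq
  rw [← hplancherel, tvDist, mul_pow]
  linarith
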